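/- If two loopy graphs G1 and G2 have the same degree sequence {k_i} and both are m*-loopy, then G1 and G2 are connected by a finite sequence of valid double edge swaps. -/

import Mathlib

open scoped Classical

/-- A loopy graph: at most one edge between any two distinct vertices and at most one
self-loop at each vertex, encoded as a symmetric adjacency relation. -/
structure LoopyGraph (V : Type) where
  Adj : V → V → Prop
  symm : ∀ u v : V, Adj u v → Adj v u

namespace LoopyGraph

variable {V : Type}

/-- The neighbors of `u` (vertices other than `u` adjacent to `u`). -/
def nbr (G : LoopyGraph V) (u : V) : Set V := {v | v ≠ u ∧ G.Adj u v}

/-- Degree of a vertex: each self-loop contributes `2`. -/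
noncomputable def deg (G : LoopyGraph V) (u : V) : ℕ :=
  (G.nbr u).ncard + (if G.Adj u u then 2 else 0)

/-- `G₂` is obtained from `G₁` by a single valid double edge swap
`(u,v),(x,y) ⤳ (u,x),(v,y)`: the two removed edges are distinct edges of `G₁`, the two
added edges are distinct and not already present (no multiedge and no doubled
self-loop is created). -/
def DoubleEdgeSwap (G₁ G₂ : LoopyGraph V) : Prop :=
  ∃ u v x y : V,
    G₁.Adj u v ∧ G₁.Adj x y ∧
    s(u, v) ≠ s(x, y) ∧
    ¬ G₁.Adj u x ∧ ¬ G₁.Adj v y ∧ s(u, x) ≠ s(v, y) ∧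
    ∀ a b : V, G₂.Adj a b ↔
      ((G₁.Adj a b ∧ s(a, b) ≠ s(u, v) ∧ s(a, b) ≠ s(x, y)) ∨
        s(a, b) = s(u, x) ∨ s(a, b) = s(v, y))

/-- `G₂` is reachable from `G₁` by a finite sequence of valid double edge swaps. -/
def Reach (G₁ G₂ : LoopyGraph V) : Prop :=
  Relation.ReflTransGen DoubleEdgeSwap G₁ G₂

/-- Vertices at (shortest-path) distance at most `k` from the set of loop-free vertices. -/
def within (G : LoopyGraph V) : ℕ → Set V
  | 0 => {v | ¬ G.Adj v v}
  | (k + 1) => within G k ∪ {v | ∃ u ∈ within G k, G.Adj v u}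

/-- `Vset G 0 = V^0` is the set of vertices with no self-loop; for `k ≥ 1`,
`Vset G k = V^k` is the set of vertices (necessarily carrying a self-loop) whose
shortest-path distance to `V^0` is exactly `k`. -/
def Vset (G : LoopyGraph V) : ℕ → Set V
  | 0 => {v | ¬ G.Adj v v}
  | (k + 1) => within G (k + 1) \ within G k

/-- `V^∞`: vertices (with a self-loop) having no path to `V^0`. -/
def Vinf (G : LoopyGraph V) : Set V := {v | ∀ k : ℕ, v ∉ within G k}

/-- A set of vertices is a clique when all pairs of distinct members are adjacent. -/
def IsClique (G : LoopyGraph V) (s : Set V) : Prop :=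
  ∀ x ∈ s, ∀ y ∈ s, x ≠ y → G.Adj x y

/-- The set of vertices carrying a self-loop. -/
def selfLoops (G : LoopyGraph V) : Set V := {v | G.Adj v v}

/-- The edges of `G` with both endpoints in `V^0`. -/
def V0edges (G : LoopyGraph V) : Set (Sym2 V) :=
  {e | ∃ u v : V, e = s(u, v) ∧ G.Adj u v ∧ u ∈ Vset G 0 ∧ v ∈ Vset G 0}

/-- `Ĝ` is swap-maximal: among all loopy graphs reachable from it by double edge swaps it
has the maximum number of self-loops, and subject to that the maximum number of edges with
both endpoints in `V^0`. -/
def SwapMaximal (G : LoopyGraph V) : Prop :=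
  ∀ H : LoopyGraph V, Reach G H →
    (selfLoops H).ncard ≤ (selfLoops G).ncard ∧
      ((selfLoops H).ncard = (selfLoops G).ncard →
        (V0edges H).ncard ≤ (V0edges G).ncard)

/-- `K` is a largest clique contained in `V^0`, and it has exactly `d` vertices. -/
def LargestV0Clique (G : LoopyGraph V) (K : Set V) (d : ℕ) : Prop :=
  K ⊆ Vset G 0 ∧ IsClique G K ∧ K.ncard = d ∧
    ∀ K' : Set V, K' ⊆ Vset G 0 → IsClique G K' → K'.ncard ≤ d

/-- Class `Q1`. -/
def Q1 (G : LoopyGraph V) : Prop :=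
  ∃ K : Set V, K ⊆ Vset G 0 ∧ 4 ≤ K.ncard ∧ IsClique G K ∧
    (∀ u ∈ Vset G 0, (∀ w ∈ Vset G 0, ¬ G.Adj u w) ∨ u ∈ K) ∧
    IsClique G (Vset G 1 ∪ K) ∧
    Vset G 2 = ∅ ∧ Vinf G = ∅

/-- Class `Q2`. -/
def Q2 (G : LoopyGraph V) : Prop :=
  3 ≤ {u | u ∈ Vset G 0 ∧ (nbr G u ∩ Vset G 0).ncard = 2}.ncard ∧
  (∀ u ∈ Vset G 0,
      (∀ w ∈ Vset G 0, ¬ G.Adj u w) ∨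
        ((nbr G u ∩ Vset G 0).ncard = 2 ∧ ∀ w ∈ Vset G 1, G.Adj u w)) ∧
  IsClique G (Vset G 1) ∧
  (∀ u ∈ Vset G 2, nbr G u = Vset G 1) ∧
  Vset G 3 = ∅ ∧
  (Vinf G = ∅ ∨ (Vset G 1 = ∅ ∧ ∀ u ∈ Vinf G, deg G u = 2))

/-- The graph of loopy graphs `𝒢({k_i})` is connected: any two loopy graphs with degree
sequence `k` are linked by a finite sequence of valid double edge swaps. -/
def GConnected (k : V → ℕ) : Prop :=
  ∀ G₁ G₂ : LoopyGraph V, (∀ v, deg G₁ v = k v) → (∀ v, deg G₂ v = k v) →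
    Reach G₁ G₂

/-- `G₂` is obtained from `G₁` by a single valid triangle-loop swap: either a triangle on
three distinct vertices is replaced by three self-loops, or conversely. -/
def TriangleLoopSwap (G₁ G₂ : LoopyGraph V) : Prop :=
  ∃ u v w : V, u ≠ v ∧ v ≠ w ∧ u ≠ w ∧
    ((G₁.Adj u v ∧ G₁.Adj v w ∧ G₁.Adj w u ∧
        ¬ G₁.Adj u u ∧ ¬ G₁.Adj v v ∧ ¬ G₁.Adj w w ∧
        ∀ a b : V, G₂.Adj a b ↔
          ((G₁.Adj a b ∧ s(a, b) ≠ s(u, v) ∧ s(a, b) ≠ s(v, w) ∧ s(a, b) ≠ s(w, u)) ∨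
            s(a, b) = s(u, u) ∨ s(a, b) = s(v, v) ∨ s(a, b) = s(w, w))) ∨
      (G₁.Adj u u ∧ G₁.Adj v v ∧ G₁.Adj w w ∧
        ¬ G₁.Adj u v ∧ ¬ G₁.Adj v w ∧ ¬ G₁.Adj w u ∧
        ∀ a b : V, G₂.Adj a b ↔
          ((G₁.Adj a b ∧ s(a, b) ≠ s(u, u) ∧ s(a, b) ≠ s(v, v) ∧ s(a, b) ≠ s(w, w)) ∨
            s(a, b) = s(u, v) ∨ s(a, b) = s(v, w) ∨ s(a, b) = s(w, u))))

/-- Reachability in the augmented graph of loopy graphs `𝒢_△`: a finite sequence of moves,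
each a valid double edge swap or a valid triangle-loop swap. -/
def ReachTri (G₁ G₂ : LoopyGraph V) : Prop :=
  Relation.ReflTransGen
    (fun H₁ H₂ => DoubleEdgeSwap H₁ H₂ ∨ TriangleLoopSwap H₁ H₂) G₁ G₂

/-- `S` is a set of highest-degree vertices for the degree sequence `k`. -/
def TopSet (k : V → ℕ) (S : Set V) : Prop :=
  ∀ u ∈ S, ∀ v : V, v ∉ S → k v ≤ k u

/-- A loopy graph is simple when it has no self-loops. -/
def IsSimple (G : LoopyGraph V) : Prop := ∀ v : V, ¬ G.Adj v v

/-- `k` is the degree sequence of some simple graph. -/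
def SimpleGraphical (k : V → ℕ) : Prop :=
  ∃ G : LoopyGraph V, IsSimple G ∧ ∀ v, deg G v = k v

/-- `k` is `m`-simple-graphical: subtracting `2` from each of the `m` largest entries
yields a simple-graphical sequence. -/
def MSimpleGraphical (k : V → ℕ) (m : ℕ) : Prop :=
  ∃ S : Set V, S.ncard = m ∧ TopSet k S ∧ (∀ v ∈ S, 2 ≤ k v) ∧
    SimpleGraphical (fun v : V => if v ∈ S then k v - 2 else k v)

/-- `m` is `m*`, the maximum `m` for which the sequence is `m`-simple-graphical. -/
def IsMStar (k : V → ℕ) (m : ℕ) : Prop :=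
  MSimpleGraphical k m ∧ ∀ m' : ℕ, MSimpleGraphical k m' → m' ≤ m

/-- `G` is `m`-loopy: it has self-loops exactly at `m` highest-degree vertices. -/
def MLoopy (G : LoopyGraph V) (m : ℕ) : Prop :=
  (selfLoops G).ncard = m ∧ TopSet (deg G) (selfLoops G)

end LoopyGraph

namespace LoopyGraph

variable {V : Type}

theorem ext_adj {G H : LoopyGraph V} (h : ∀ a b, G.Adj a b ↔ H.Adj a b) : G = H := by
  cases G
  cases H
  congr
  ext a b
  exact h a b

theorem adj_comm (G : LoopyGraph V) (a b : V) : G.Adj a b ↔ G.Adj b a :=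
  ⟨G.symm a b, G.symm b a⟩

/-- Replace the edges `(u,v)`, `(x,y)` by `(u,x)`, `(v,y)`. -/
def swap (G : LoopyGraph V) (u v x y : V) : LoopyGraph V where
  Adj a b := (G.Adj a b ∧ s(a, b) ≠ s(u, v) ∧ s(a, b) ≠ s(x, y)) ∨
    s(a, b) = s(u, x) ∨ s(a, b) = s(v, y)
  symm a b h := by rwa [Sym2.eq_swap, G.adj_comm]

theorem doubleEdgeSwap_swap {G : LoopyGraph V} {u v x y : V} (huv : G.Adj u v) (hxy : G.Adj x y)
    (hne : s(u, v) ≠ s(x, y)) (hux : ¬ G.Adj u x) (hvy : ¬ G.Adj v y)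
    (hne' : s(u, x) ≠ s(v, y)) : DoubleEdgeSwap G (G.swap u v x y) :=
  ⟨u, v, x, y, huv, hxy, hne, hux, hvy, hne', fun _ _ => Iff.rfl⟩

theorem adj_congr {G : LoopyGraph V} {a b c d : V} (h : s(a, b) = s(c, d)) :
    G.Adj a b ↔ G.Adj c d := by
  rcases Sym2.eq_iff.1 h with ⟨rfl, rfl⟩ | ⟨rfl, rfl⟩
  · rfl
  · exact G.adj_comm a b

theorem DoubleEdgeSwap.symm {G H : LoopyGraph V} (h : DoubleEdgeSwap G H) :
    DoubleEdgeSwap H G := by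
  obtain ⟨u, v, x, y, huv, hxy, hne, hux, hvy, hne', h⟩ := h
  have key : ∀ {a b c d : V}, G.Adj a b → ¬ G.Adj c d → s(a, b) ≠ s(c, d) :=
    fun h₁ h₂ h₃ => h₂ ((adj_congr h₃).1 h₁)
  refine ⟨u, x, v, y, (h _ _).2 (by simp), (h _ _).2 (by simp), hne', ?_, ?_, hne, ?_⟩
  · rw [h]
    simp only [key huv hux, key huv hvy, ne_eq, not_true, false_and, and_false, or_false,
      not_false_eq_true]
  · rw [h]
    simp only [key hxy hux, key hxy hvy, ne_eq, not_true, and_false, or_false,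
      not_false_eq_true]
  · intro a b
    rw [h]
    have e₁ : s(a, b) = s(u, v) → G.Adj a b := fun e => (adj_congr e).2 huv
    have e₂ : s(a, b) = s(x, y) → G.Adj a b := fun e => (adj_congr e).2 hxy
    have e₃ : s(a, b) = s(u, x) → ¬ G.Adj a b := fun e e' => hux ((adj_congr e).1 e')
    have e₄ : s(a, b) = s(v, y) → ¬ G.Adj a b := fun e e' => hvy ((adj_congr e).1 e')
    tauto

theorem Reach.symm {G H : LoopyGraph V} (h : Reach G H) : Reach H G :=
  Relation.ReflTransGen.head_induction_on h .refl fun h₁ _ h₂ => .tail h₂ h₁.symm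

theorem ncard_nbr_eq {G H : LoopyGraph V} {a : V} (h : G.deg a = H.deg a)
    (hl : G.Adj a a ↔ H.Adj a a) : (G.nbr a).ncard = (H.nbr a).ncard := by
  simp only [deg, hl] at h
  omega

theorem swap_indicator {P p q r s : Prop} [Decidable P] [Decidable p] [Decidable q]
    [Decidable r] [Decidable s] (hp : p → P) (hq : q → P) (hr : r → ¬ P) (hs : s → ¬ P)
    (hpq : p → ¬ q) (hrs : r → ¬ s) :
    (if (P ∧ ¬ p ∧ ¬ q) ∨ r ∨ s then (1 : ℤ) else 0) = (if P then 1 else 0)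
      - (if p then 1 else 0) - (if q then 1 else 0)
      + (if r then 1 else 0) + (if s then 1 else 0) := by
  split_ifs <;> grind

section Degree

variable [Fintype V]

theorem deg_eq_sum (G : LoopyGraph V) (a : V) :
    (G.deg a : ℤ) = ∑ b, (if G.Adj a b then 1 else 0) + (if G.Adj a a then 1 else 0) := by
  have h₁ : (G.nbr a).ncard = ∑ b ∈ Finset.univ.erase a, (if G.Adj a b then 1 else 0) := by
    rw [← Finset.card_filter, ← Set.ncard_coe_finset]
    congr 1
    ext b
    simp [nbr]
  rw [← Finset.add_sum_erase _ _ (Finset.mem_univ a), deg, h₁]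
  push_cast
  split_ifs <;> ring

theorem sum_edge_indicator (a u v : V) :
    ∑ b, (if s(a, b) = s(u, v) then (1 : ℤ) else 0) + (if s(a, a) = s(u, v) then 1 else 0) =
      (if a = u then 1 else 0) + (if a = v then 1 else 0) := by
  by_cases hu : a = u
  · subst hu
    by_cases hv : a = v
    · subst hv
      simp
    · simp [hv]
  · by_cases hv : a = v
    · subst hv
      simp [hu]
    · simp [hu, hv]

theorem DoubleEdgeSwap.deg_eq {G H : LoopyGraph V} (h : DoubleEdgeSwap G H) (a : V) :
    H.deg a = G.deg a := by
  obtain ⟨u, v, x, y, huv, hxy, hne, hux, hvy, hne', h⟩ := h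
  have key : ∀ b, (if H.Adj a b then (1 : ℤ) else 0) = (if G.Adj a b then 1 else 0)
      - (if s(a, b) = s(u, v) then 1 else 0) - (if s(a, b) = s(x, y) then 1 else 0)
      + (if s(a, b) = s(u, x) then 1 else 0) + (if s(a, b) = s(v, y) then 1 else 0) := by
    intro b
    have e₁ : s(a, b) = s(u, v) → G.Adj a b := fun e => (adj_congr e).2 huv
    have e₂ : s(a, b) = s(x, y) → G.Adj a b := fun e => (adj_congr e).2 hxy
    have e₃ : s(a, b) = s(u, x) → ¬ G.Adj a b := fun e e' => hux ((adj_congr e).1 e')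
    have e₄ : s(a, b) = s(v, y) → ¬ G.Adj a b := fun e e' => hvy ((adj_congr e).1 e')
    have e₅ : s(a, b) = s(u, v) → s(a, b) ≠ s(x, y) := fun e e' => hne (e.symm.trans e')
    have e₆ : s(a, b) = s(u, x) → s(a, b) ≠ s(v, y) := fun e e' => hne' (e.symm.trans e')
    rw [if_congr (h a b) rfl rfl]
    exact swap_indicator e₁ e₂ e₃ e₄ e₅ e₆
  have := sum_edge_indicator a u v
  have := sum_edge_indicator a x y
  have := sum_edge_indicator a u x
  have := sum_edge_indicator a v y
  have hH := H.deg_eq_sum a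
  have hG := G.deg_eq_sum a
  rw [key a, Finset.sum_congr rfl fun b _ => key b] at hH
  simp only [Finset.sum_add_distrib, Finset.sum_sub_distrib] at hH
  zify
  linarith

theorem Reach.deg_eq {G H : LoopyGraph V} (h : Reach G H) (a : V) : H.deg a = G.deg a := by
  induction h with
  | refl => rfl
  | tail _ h ih => rw [h.deg_eq, ih]

/-- A swap making `v` adjacent to `a` instead of `b` while keeping the edges at `F`. -/
theorem exists_reach_exchange (G : LoopyGraph V) {F : Set V} {v a b : V} (hv : v ∉ F)
    (ha : a ∉ F) (hb : b ∉ F) (hav : a ≠ v) (hbv : b ≠ v) (hvb : G.Adj v b) (hva : ¬ G.Adj v a)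
    (hle : (G.nbr b \ F).ncard ≤ (G.nbr a \ F).ncard) :
    ∃ H, Reach G H ∧ (∀ w, H.Adj w w ↔ G.Adj w w) ∧
      (∀ w ∈ F, ∀ z, H.Adj w z ↔ G.Adj w z) ∧
      ∀ z, H.Adj v z ↔ (G.Adj v z ∧ z ≠ b) ∨ z = a := by
  have hab : a ≠ b := by
    rintro rfl
    exact hva hvb
  obtain ⟨c, hcF, hca, hcb, hac, hbc⟩ :
      ∃ c, c ∉ F ∧ c ≠ a ∧ c ≠ b ∧ G.Adj a c ∧ ¬ G.Adj b c := by
    by_contra hcon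
    push Not at hcon
    have hlt : ((G.nbr a \ F) \ {b}).ncard < ((G.nbr b \ F) \ {a}).ncard := by
      refine Set.ncard_lt_ncard ⟨?_, fun hsub => ?_⟩ (Set.toFinite _)
      · rintro c ⟨⟨⟨hca, hac⟩, hcF⟩, hcb⟩
        exact ⟨⟨⟨hcb, hcon c hcF hca hcb hac⟩, hcF⟩, hca⟩
      · have := hsub (show v ∈ (G.nbr b \ F) \ {a} from
          ⟨⟨⟨hbv.symm, G.symm _ _ hvb⟩, hv⟩, hav.symm⟩)
        exact hva (G.symm _ _ this.1.1.2)
    by_cases hadj : G.Adj a b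
    · rw [Set.ncard_sdiff_singleton_of_mem, Set.ncard_sdiff_singleton_of_mem] at hlt
      · omega
      · exact ⟨⟨hab, G.symm _ _ hadj⟩, ha⟩
      · exact ⟨⟨hab.symm, hadj⟩, hb⟩
    · rw [Set.sdiff_singleton_eq_self, Set.sdiff_singleton_eq_self] at hlt
      · omega
      · exact fun h => hadj (G.symm _ _ h.1.2)
      · exact fun h => hadj h.1.2
  have hcv : c ≠ v := by
    rintro rfl
    exact hva (G.symm _ _ hac)
  refine ⟨G.swap v b a c, .single (doubleEdgeSwap_swap hvb hac ?_ hva hbc ?_), ?_, ?_, ?_⟩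
  · grind
  · grind
  · intro w
    simp only [swap]
    grind
  · intro w hw z
    simp only [swap]
    grind
  · intro z
    simp only [swap]
    grind

theorem ncard_nbr_diff_eq {G H : LoopyGraph V} {F : Set V} (hdeg : ∀ w, G.deg w = H.deg w)
    (hl : ∀ w, G.Adj w w ↔ H.Adj w w) (hF : ∀ w ∈ F, ∀ z, G.Adj w z ↔ H.Adj w z) (a : V) :
    (G.nbr a \ F).ncard = (H.nbr a \ F).ncard := by
  have h₁ := Set.ncard_inter_add_ncard_sdiff_eq_ncard (G.nbr a) F (Set.toFinite _)
  have h₂ := Set.ncard_inter_add_ncard_sdiff_eq_ncard (H.nbr a) F (Set.toFinite _)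
  have h₃ : G.nbr a ∩ F = H.nbr a ∩ F := by
    ext w
    simp only [nbr, Set.mem_inter_iff, Set.mem_ofPred_eq]
    rw [G.adj_comm, H.adj_comm]
    grind
  rw [h₃] at h₁
  have := ncard_nbr_eq (hdeg a) (hl a)
  omega

/-- Two graphs with the same degrees and loops which agree at `F` can be transformed so that
they moreover agree at `v`. -/
theorem exists_reach_agree {F : Set V} {v : V} (hv : v ∉ F) (n : ℕ) :
    ∀ G H : LoopyGraph V, {z | ¬ (G.Adj v z ↔ H.Adj v z)}.ncard ≤ n →
      (∀ w, G.deg w = H.deg w) → (∀ w, G.Adj w w ↔ H.Adj w w) →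
      (∀ w ∈ F, ∀ z, G.Adj w z ↔ H.Adj w z) →
      ∃ G' H', Reach G G' ∧ Reach H H' ∧ (∀ w, G'.Adj w w ↔ H'.Adj w w) ∧
        ∀ w ∈ insert v F, ∀ z, G'.Adj w z ↔ H'.Adj w z := by
  induction n with
  | zero =>
    intro G H hn hdeg hl hF
    refine ⟨G, H, .refl, .refl, hl, ?_⟩
    rintro w (rfl | hw)
    · have := (Set.ncard_eq_zero (Set.toFinite _)).1 (Nat.le_zero.1 hn)
      intro z
      by_contra hz
      exact (this ▸ (show z ∈ {z | ¬ (G.Adj w z ↔ H.Adj w z)} from hz) : z ∈ (∅ : Set V))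
    · exact hF w hw
  | succ n ih =>
    intro G H hn hdeg hl hF
    have hcard := ncard_nbr_eq (hdeg v) (hl v)
    by_cases heq : G.nbr v = H.nbr v
    · refine ⟨G, H, .refl, .refl, hl, ?_⟩
      rintro w (rfl | hw) z
      · by_cases hz : z = w
        · subst hz
          exact hl z
        · have := Set.ext_iff.1 heq z
          simpa [nbr, hz] using this
      · exact hF w hw z
    obtain ⟨a, ⟨hav, hGa⟩, hHa⟩ : ∃ a, a ∈ G.nbr v ∧ a ∉ H.nbr v := Set.not_subset.1 fun hs =>
      heq (Set.eq_of_subset_of_ncard_le hs hcard.ge (Set.toFinite _))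
    obtain ⟨b, ⟨hbv, hHb⟩, hGb⟩ : ∃ b, b ∈ H.nbr v ∧ b ∉ G.nbr v := Set.not_subset.1 fun hs =>
      heq (Set.eq_of_subset_of_ncard_le hs hcard.le (Set.toFinite _)).symm
    replace hHa : ¬ H.Adj v a := fun h => hHa ⟨hav, h⟩
    replace hGb : ¬ G.Adj v b := fun h => hGb ⟨hbv, h⟩
    have haF : a ∉ F := fun h => hHa (H.symm _ _ ((hF a h v).1 (G.symm _ _ hGa)))
    have hbF : b ∉ F := fun h => hGb (G.symm _ _ ((hF b h v).2 (H.symm _ _ hHb)))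
    rcases le_total (H.nbr b \ F).ncard (H.nbr a \ F).ncard with hle | hle
    · obtain ⟨K, hHK, hKl, hKF, hKv⟩ :=
        H.exists_reach_exchange hv haF hbF hav hbv hHb hHa hle
      obtain ⟨G', H', hG', hH', h⟩ := ih G K (by
        refine Nat.le_of_lt_succ (lt_of_lt_of_le (Set.ncard_lt_ncard ⟨?_, ?_⟩) hn)
        · intro z
          simp only [Set.mem_ofPred_eq, hKv]
          grind
        · intro hs
          exact hs (show a ∈ _ from fun h => hHa (h.1 hGa))
            ⟨fun _ => (hKv a).2 (.inr rfl), fun _ => hGa⟩)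
        (fun w => by rw [hHK.deg_eq, hdeg]) (fun w => by rw [hKl, hl])
        (fun w hw z => by rw [hKF w hw, hF w hw])
      exact ⟨G', H', hG', hHK.trans hH', h⟩
    · rw [← ncard_nbr_diff_eq hdeg hl hF, ← ncard_nbr_diff_eq hdeg hl hF] at hle
      obtain ⟨K, hGK, hKl, hKF, hKv⟩ :=
        G.exists_reach_exchange hv hbF haF hbv hav hGa hGb hle
      obtain ⟨G', H', hG', hH', h⟩ := ih K H (by
        refine Nat.le_of_lt_succ (lt_of_lt_of_le (Set.ncard_lt_ncard ⟨?_, ?_⟩) hn)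
        · intro z
          simp only [Set.mem_ofPred_eq, hKv]
          grind
        · intro hs
          exact hs (show b ∈ _ from fun h => hGb (h.2 hHb))
            ⟨fun _ => hHb, fun _ => (hKv b).2 (.inr rfl)⟩)
        (fun w => by rw [hGK.deg_eq, hdeg]) (fun w => by rw [hKl, hl])
        (fun w hw z => by rw [hKF w hw, hF w hw])
      exact ⟨G', H', hGK.trans hG', hH', h⟩

theorem reach_of_agree (n : ℕ) : ∀ (F : Set V) (G H : LoopyGraph V), (Fᶜ).ncard ≤ n →
    (∀ w, G.deg w = H.deg w) → (∀ w, G.Adj w w ↔ H.Adj w w) →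
    (∀ w ∈ F, ∀ z, G.Adj w z ↔ H.Adj w z) → Reach G H := by
  induction n with
  | zero =>
    intro F G H hn hdeg hl hF
    have hu := Set.compl_empty_iff.1 ((Set.ncard_eq_zero (Set.toFinite _)).1 (Nat.le_zero.1 hn))
    rw [ext_adj fun a b => hF a (hu ▸ Set.mem_univ a) b]
    exact .refl
  | succ n ih =>
    intro F G H hn hdeg hl hF
    by_cases hv : ∃ v, v ∉ F
    · obtain ⟨v, hv⟩ := hv
      obtain ⟨G', H', hG, hH, hl', hF'⟩ := exists_reach_agree hv _ G H le_rfl hdeg hl hF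
      refine hG.trans (Relation.ReflTransGen.trans (ih (insert v F) G' H' ?_ ?_ hl' hF') hH.symm)
      · refine Nat.le_of_lt_succ (lt_of_lt_of_le (Set.ncard_lt_ncard ⟨?_, ?_⟩) hn)
        · exact Set.compl_subset_compl.2 (Set.subset_insert _ _)
        · exact fun hs => hs hv (Set.mem_insert _ _)
      · intro w
        rw [hG.deg_eq, hH.deg_eq, hdeg]
    · push Not at hv
      rw [ext_adj fun a b => hF a (hv a) b]
      exact .refl

/-- Graphs with the same degrees and the same loops are connected by swaps. -/
theorem reach_of_same_loops {G H : LoopyGraph V} (hdeg : ∀ w, G.deg w = H.deg w)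
    (hl : selfLoops G = selfLoops H) : Reach G H :=
  reach_of_agree _ ∅ G H le_rfl hdeg (fun w => Set.ext_iff.1 hl w) (by simp)

/-- A loop can be moved between two vertices of equal degree. -/
theorem exists_reach_move_loop (G : LoopyGraph V) {u v : V} (hu : G.Adj u u) (hv : ¬ G.Adj v v)
    (hdeg : G.deg u = G.deg v) :
    ∃ H, Reach G H ∧ selfLoops H = insert v (selfLoops G \ {u}) := by
  have huv : u ≠ v := by
    rintro rfl
    exact hv hu
  have hcard : (G.nbr v).ncard = (G.nbr u).ncard + 2 := by
    simp only [deg, hu, hv, if_true, if_false] at hdeg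
    omega
  have hcard' : (G.nbr v \ {u}).ncard = (G.nbr u \ {v}).ncard + 2 := by
    by_cases hadj : G.Adj u v
    · have h₁ := Set.ncard_sdiff_singleton_add_one (s := G.nbr v) (a := u)
        ⟨huv, G.symm _ _ hadj⟩ (Set.toFinite _)
      have h₂ := Set.ncard_sdiff_singleton_add_one (s := G.nbr u) (a := v)
        ⟨huv.symm, hadj⟩ (Set.toFinite _)
      omega
    · rwa [Set.sdiff_singleton_eq_self fun h => hadj (G.symm _ _ h.2),
        Set.sdiff_singleton_eq_self fun h => hadj h.2]
  have hlt : 1 < ((G.nbr v \ {u}) \ (G.nbr u \ {v})).ncard := by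
    have := Set.le_ncard_sdiff (G.nbr u \ {v}) (G.nbr v \ {u}) (Set.toFinite _)
    omega
  obtain ⟨a, b, ⟨⟨⟨hav, hva⟩, hau⟩, hua⟩, ⟨⟨⟨hbv, hvb⟩, hbu⟩, hub⟩, hab⟩ :=
    (Set.one_lt_ncard_iff (Set.toFinite _)).1 hlt
  replace hau : a ≠ u := hau
  replace hbu : b ≠ u := hbu
  replace hua : ¬ G.Adj u a := fun h => hua ⟨⟨hau, h⟩, hav⟩
  replace hub : ¬ G.Adj u b := fun h => hub ⟨⟨hbu, h⟩, hbv⟩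
  by_cases hadj : G.Adj u v
  · have s₁ : DoubleEdgeSwap G (G.swap v u v a) :=
      doubleEdgeSwap_swap (G.symm _ _ hadj) hva (by grind) hv hua (by grind)
    have s₂ : DoubleEdgeSwap (G.swap v u v a) ((G.swap v u v a).swap u u v b) := by
      apply doubleEdgeSwap_swap <;> simp only [swap, ne_eq, Sym2.eq_iff] <;> grind
    refine ⟨_, .tail (.single s₁) s₂, ?_⟩
    ext w
    simp only [selfLoops, swap, Set.mem_ofPred_eq, Set.mem_insert_iff, Set.mem_sdiff,
      Set.mem_singleton_iff, ne_eq, Sym2.eq_iff]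
    grind
  · have s₁ : DoubleEdgeSwap G (G.swap u u v a) :=
      doubleEdgeSwap_swap hu hva (by grind) hadj hua (by grind)
    have s₂ : DoubleEdgeSwap (G.swap u u v a) ((G.swap u u v a).swap v u v b) := by
      apply doubleEdgeSwap_swap <;> simp only [swap, ne_eq, Sym2.eq_iff] <;> grind
    refine ⟨_, .tail (.single s₁) s₂, ?_⟩
    ext w
    simp only [selfLoops, swap, Set.mem_ofPred_eq, Set.mem_insert_iff, Set.mem_sdiff,
      Set.mem_singleton_iff, ne_eq, Sym2.eq_iff]
    grind

/-- Graphs with the same degrees and equally many loops are connected by swaps as soon as the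
vertices at which their loops differ have equal degrees. -/
theorem reach_of_loops_tied {H : LoopyGraph V} (n : ℕ) : ∀ G : LoopyGraph V,
    (selfLoops G \ selfLoops H).ncard ≤ n → (∀ w, G.deg w = H.deg w) →
    (selfLoops G).ncard = (selfLoops H).ncard →
    (∀ u ∈ selfLoops G \ selfLoops H, ∀ v ∈ selfLoops H \ selfLoops G, H.deg u = H.deg v) →
    Reach G H := by
  induction n with
  | zero =>
    intro G hn hdeg hcard _
    refine reach_of_same_loops hdeg (Set.eq_of_subset_of_ncard_le ?_ hcard.ge (Set.toFinite _))
    exact Set.sdiff_eq_empty.1 ((Set.ncard_eq_zero (Set.toFinite _)).1 (Nat.le_zero.1 hn))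
  | succ n ih =>
    intro G hn hdeg hcard htie
    by_cases hl : selfLoops G = selfLoops H
    · exact reach_of_same_loops hdeg hl
    obtain ⟨u, huG, huH⟩ := Set.not_subset.1 fun hs : selfLoops G ⊆ selfLoops H =>
      hl (Set.eq_of_subset_of_ncard_le hs hcard.ge (Set.toFinite _))
    obtain ⟨v, hvH, hvG⟩ := Set.not_subset.1 fun hs : selfLoops H ⊆ selfLoops G =>
      hl (Set.eq_of_subset_of_ncard_le hs hcard.le (Set.toFinite _)).symm
    obtain ⟨K, hGK, hK⟩ := G.exists_reach_move_loop huG hvG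
      (by rw [hdeg, hdeg, htie u ⟨huG, huH⟩ v ⟨hvH, hvG⟩])
    refine hGK.trans (ih K ?_ (fun w => by rw [hGK.deg_eq, hdeg]) ?_ ?_)
    · refine Nat.le_of_lt_succ (lt_of_lt_of_le (Set.ncard_lt_ncard ⟨?_, ?_⟩) hn)
      · rw [hK]
        grind
      · intro hs
        have := hs (show u ∈ selfLoops G \ selfLoops H from ⟨huG, huH⟩)
        rw [hK] at this
        grind
    · rw [hK, ← hcard]
      exact Set.ncard_exchange hvG huG
    · rw [hK]
      intro x hx y hy
      refine htie x ?_ y ?_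
      · grind
      · grind

end Degree

end LoopyGraph

/-- Two `m*`-loopy graphs with the same degree sequence are connected by a
finite sequence of valid double edge swaps. -/
theorem mStar_loopy_connected {V : Type} [Fintype V] (k : V → ℕ) (m : ℕ)
    (hm : LoopyGraph.IsMStar k m)
    (G₁ G₂ : LoopyGraph V) (h₁ : ∀ v, G₁.deg v = k v) (h₂ : ∀ v, G₂.deg v = k v)
    (hl₁ : G₁.MLoopy m) (hl₂ : G₂.MLoopy m) :
    LoopyGraph.Reach G₁ G₂ := by
  refine LoopyGraph.reach_of_loops_tied _ G₁ le_rfl (fun w => by rw [h₁, h₂])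
    (hl₁.1.trans hl₂.1.symm) fun u hu v hv => le_antisymm ?_ ?_
  · exact hl₂.2 v hv.1 u hu.2
  · have := hl₁.2 u hu.1 v hv.2
    rwa [h₁, h₁, ← h₂, ← h₂] at this
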